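/- Let L ∈ ℝ^{n1×n2} and let r be an integer with rank(L) ≤ r ≤ min{n1, n2}. There exists ν̄ > 0 such that for every ν with 0 < ν < ν̄ and every function ψ admissible for ν, a matrix Z* ∈ Ω minimizes ‖Z‖_{F,0} over Ω if and only if Z* minimizes ‖Z‖_{F,1}^ψ over Ω. (Coincidence of global minimizers in the matrix, i.e. single-frontal-slice, case of Theorem 3.2.) -/

import Mathlib

open scoped Matrix

/-- Euclidean norm of the `j`-th column of a real matrix. -/
noncomputable def colNorm {n r : ℕ} (Z : Matrix (Fin n) (Fin r) ℝ) (j : Fin r) : ℝ :=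
  Real.sqrt (∑ i, (Z i j) ^ 2)

/-- Column sparsity `‖Z‖_{F,0}`: the number of nonzero columns of `Z`. -/
noncomputable def colSparsity {n r : ℕ} (Z : Matrix (Fin n) (Fin r) ℝ) : ℕ :=
  {j : Fin r | (fun i => Z i j) ≠ 0}.ncard

/-- Frobenius norm of a real matrix. -/
noncomputable def frobNorm {n r : ℕ} (X : Matrix (Fin n) (Fin r) ℝ) : ℝ :=
  Real.sqrt (∑ i, ∑ j, (X i j) ^ 2)

/-- `Ω`: matrices `Z` admitting an orthonormal factor `D` with `DᵀD = I` and `L = D Zᵀ`. -/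
def Omega {n1 n2 : ℕ} (r : ℕ) (L : Matrix (Fin n1) (Fin n2) ℝ) :
    Set (Matrix (Fin n2) (Fin r) ℝ) :=
  {Z | ∃ D : Matrix (Fin n1) (Fin r) ℝ, Dᵀ * D = 1 ∧ L = D * Zᵀ}

/-- `Q^s`: matrices with at most `s` nonzero columns. -/
def Qset (n r : ℕ) (s : ℕ) : Set (Matrix (Fin n) (Fin r) ℝ) :=
  {Z | colSparsity Z ≤ s}

/-- Frobenius distance from `Z` to the set `Q^s`. -/
noncomputable def distQ {n r : ℕ} (Z : Matrix (Fin n) (Fin r) ℝ) (s : ℕ) : ℝ :=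
  sInf {d : ℝ | ∃ Z' ∈ Qset n r s, d = frobNorm (Z - Z')}

/-- `ψ` is admissible for `ν`: `ψ(0)=0`, `x/ν ≤ ψ(x) < 1` on `(0,ν)`, `ψ(x)=1` on `[ν,∞)`. -/
def Admissible (ν : ℝ) (ψ : ℝ → ℝ) : Prop :=
  ψ 0 = 0 ∧ (∀ x : ℝ, 0 < x → x < ν → x / ν ≤ ψ x ∧ ψ x < 1) ∧ ∀ x : ℝ, ν ≤ x → ψ x = 1

/-- `‖Z‖_{F,1}^ψ = Σ_j ψ(‖Z(:,j)‖₂)`. -/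
noncomputable def psiNorm {n r : ℕ} (ψ : ℝ → ℝ) (Z : Matrix (Fin n) (Fin r) ℝ) : ℝ :=
  ∑ j, ψ (colNorm Z j)

lemma colNorm_nonneg {n r : ℕ} (Z : Matrix (Fin n) (Fin r) ℝ) (j : Fin r) : 0 ≤ colNorm Z j :=
  Real.sqrt_nonneg _

lemma colNorm_eq_zero_iff {n r : ℕ} (Z : Matrix (Fin n) (Fin r) ℝ) (j : Fin r) :
    colNorm Z j = 0 ↔ (fun i => Z i j) = 0 := by
  rw [colNorm, Real.sqrt_eq_zero (Finset.sum_nonneg fun i _ => sq_nonneg _),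
    Finset.sum_eq_zero_iff_of_nonneg fun i _ => sq_nonneg _]
  simp [funext_iff]

lemma continuous_colNorm {n r : ℕ} (j : Fin r) :
    Continuous fun Z : Matrix (Fin n) (Fin r) ℝ => colNorm Z j := by
  unfold colNorm
  have h (i : Fin n) : Continuous fun Z : Matrix (Fin n) (Fin r) ℝ => Z i j :=
    continuous_id.matrix_elem i j
  fun_prop

lemma colSparsity_eq_card {n r : ℕ} (Z : Matrix (Fin n) (Fin r) ℝ) :
    colSparsity Z = (Finset.univ.filter fun j => colNorm Z j ≠ 0).card := by
  rw [colSparsity, ← Set.ncard_coe_finset]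
  congr 1
  ext j
  simp [colNorm_eq_zero_iff]

lemma colSparsity_le_card {n r : ℕ} {Z : Matrix (Fin n) (Fin r) ℝ} {T : Finset (Fin r)}
    (h : ∀ j ∉ T, colNorm Z j = 0) : colSparsity Z ≤ T.card := by
  rw [colSparsity_eq_card]
  refine Finset.card_le_card fun j hj => ?_
  by_contra hT
  exact (Finset.mem_filter.mp hj).2 (h j hT)

namespace Admissible

variable {ν : ℝ} {ψ : ℝ → ℝ}

lemma pos_of_pos (hψ : Admissible ν ψ) {x : ℝ} (hν : 0 < ν) (hx : 0 < x) : 0 < ψ x := by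
  rcases lt_or_ge x ν with h | h
  · exact (div_pos hx hν).trans_le (hψ.2.1 x hx h).1
  · simp [hψ.2.2 x h]

lemma nonneg (hψ : Admissible ν ψ) {x : ℝ} (hν : 0 < ν) (hx : 0 ≤ x) : 0 ≤ ψ x := by
  rcases hx.eq_or_lt with rfl | h
  · exact hψ.1.ge
  · exact (hψ.pos_of_pos hν h).le

lemma le_one (hψ : Admissible ν ψ) {x : ℝ} (hx : 0 < x) : ψ x ≤ 1 := by
  rcases lt_or_ge x ν with h | h
  · exact (hψ.2.1 x hx h).2.le
  · exact (hψ.2.2 x h).le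

lemma psiNorm_le_colSparsity (hψ : Admissible ν ψ) {n r : ℕ} (Z : Matrix (Fin n) (Fin r) ℝ) :
    psiNorm ψ Z ≤ colSparsity Z := by
  rw [colSparsity_eq_card, Finset.natCast_card_filter, psiNorm]
  refine Finset.sum_le_sum fun j _ => ?_
  split_ifs with h
  · exact hψ.le_one ((colNorm_nonneg Z j).lt_of_ne' h)
  · rw [not_not.mp h, hψ.1]

lemma psiNorm_eq_card_add (hψ : Admissible ν ψ) {n r : ℕ} (Z : Matrix (Fin n) (Fin r) ℝ) :
    psiNorm ψ Z = (Finset.univ.filter fun j => ν ≤ colNorm Z j).card +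
      ∑ j with ¬ ν ≤ colNorm Z j, ψ (colNorm Z j) := by
  rw [psiNorm, ← Finset.sum_filter_add_sum_filter_not _ fun j => ν ≤ colNorm Z j]
  congr 1
  rw [Finset.sum_congr rfl fun j hj => hψ.2.2 _ (Finset.mem_filter.mp hj).2]
  simp

lemma card_le_psiNorm (hψ : Admissible ν ψ) (hν : 0 < ν) {n r : ℕ}
    (Z : Matrix (Fin n) (Fin r) ℝ) :
    ((Finset.univ.filter fun j => ν ≤ colNorm Z j).card : ℝ) ≤ psiNorm ψ Z := by
  rw [hψ.psiNorm_eq_card_add]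
  exact le_add_of_nonneg_right
    (Finset.sum_nonneg fun j _ => hψ.nonneg hν (colNorm_nonneg Z j))

lemma colSparsity_le_card_of_psiNorm_le (hψ : Admissible ν ψ) (hν : 0 < ν) {n r : ℕ}
    {Z : Matrix (Fin n) (Fin r) ℝ}
    (h : psiNorm ψ Z ≤ (Finset.univ.filter fun j => ν ≤ colNorm Z j).card) :
    colSparsity Z ≤ (Finset.univ.filter fun j => ν ≤ colNorm Z j).card := by
  have hnonneg : ∀ j ∈ Finset.univ.filter fun j => ¬ ν ≤ colNorm Z j, 0 ≤ ψ (colNorm Z j) :=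
    fun j _ => hψ.nonneg hν (colNorm_nonneg Z j)
  rw [hψ.psiNorm_eq_card_add] at h
  have hzero := (Finset.sum_eq_zero_iff_of_nonneg hnonneg).mp
    (le_antisymm (by linarith) (Finset.sum_nonneg hnonneg))
  refine colSparsity_le_card fun j hj => ?_
  by_contra hne
  exact (hψ.pos_of_pos hν ((colNorm_nonneg Z j).lt_of_ne' hne)).ne' (hzero j (by simpa using hj))

end Admissible

lemma isCompact_orthonormal_columns (m r : ℕ) :
    IsCompact {D : Matrix (Fin m) (Fin r) ℝ | Dᵀ * D = 1} := by
  have hbox : IsCompact {D : Matrix (Fin m) (Fin r) ℝ | ∀ i j, D i j ∈ Set.Icc (-1 : ℝ) 1} := by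
    exact isCompact_pi_infinite (X := fun _ : Fin m => Fin r → ℝ) fun _ =>
      isCompact_pi_infinite (X := fun _ : Fin r => ℝ) fun _ =>
        isCompact_Icc (a := (-1 : ℝ)) (b := 1)
  refine hbox.of_isClosed_subset (isClosed_eq (by fun_prop) continuous_const) fun D hD i j => ?_
  have hsum : ∑ k, D k j * D k j = 1 := by
    simpa [Matrix.mul_apply] using congrFun (congrFun hD j) j
  have hle : D i j * D i j ≤ 1 := hsum ▸
    Finset.single_le_sum (f := fun k => D k j * D k j) (fun k _ => mul_self_nonneg _)
      (Finset.mem_univ i)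
  exact ⟨by nlinarith, by nlinarith⟩

lemma isCompact_Omega {n1 n2 : ℕ} (r : ℕ) (L : Matrix (Fin n1) (Fin n2) ℝ) :
    IsCompact (Omega r L) := by
  have himage : Omega r L = (fun D : Matrix (Fin n1) (Fin r) ℝ => Lᵀ * D) ''
      ({D | Dᵀ * D = 1} ∩ {D | L = D * (Lᵀ * D)ᵀ}) := by
    ext Z
    constructor
    · rintro ⟨D, hD, hL⟩
      have hZ : Lᵀ * D = Z := by
        rw [hL, Matrix.transpose_mul, Matrix.transpose_transpose, Matrix.mul_assoc, hD,
          Matrix.mul_one]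
      exact ⟨D, ⟨hD, by rwa [Set.mem_ofPred_eq, hZ]⟩, hZ⟩
    · rintro ⟨D, ⟨hD, hL⟩, rfl⟩
      exact ⟨D, hD, hL⟩
  rw [himage]
  exact ((isCompact_orthonormal_columns n1 r).inter_right
    (isClosed_eq continuous_const (by fun_prop))).image (by fun_prop)

lemma IsCompact.exists_pos_le_card_colNorm_ge {n r s : ℕ} {K : Set (Matrix (Fin n) (Fin r) ℝ)}
    (hK : IsCompact K) (hs : ∀ Z ∈ K, s ≤ colSparsity Z) :
    ∃ ε > 0, ∀ ν < ε, ∀ Z ∈ K, s ≤ (Finset.univ.filter fun j => ν ≤ colNorm Z j).card := by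
  have hsum (T : Finset (Fin r)) :
      ∃ c > 0, T.card < s → ∀ Z ∈ K, c ≤ ∑ j ∈ Tᶜ, colNorm Z j := by
    by_cases hT : T.card < s
    · rcases K.eq_empty_or_nonempty with rfl | hne
      · exact ⟨1, one_pos, by simp⟩
      obtain ⟨Z, hZ, hmin⟩ := hK.exists_isMinOn hne
        (continuous_finsetSum Tᶜ fun j _ => continuous_colNorm j).continuousOn
      refine ⟨_, lt_of_not_ge fun hle => ?_, fun _ Z' hZ' => hmin hZ'⟩
      have hzero := (Finset.sum_eq_zero_iff_of_nonneg fun j _ => colNorm_nonneg Z j).mp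
        (le_antisymm hle (Finset.sum_nonneg fun j _ => colNorm_nonneg Z j))
      have := colSparsity_le_card fun j hj => hzero j (Finset.mem_compl.mpr hj)
      exact absurd (hs Z hZ) (by omega)
    · exact ⟨1, one_pos, fun h => absurd h hT⟩
  choose c hc hcT using hsum
  obtain ⟨T₀, hT₀⟩ := Finite.exists_min c
  refine ⟨c T₀ / (r + 1), by have := hc T₀; positivity, fun ν hν Z hZ => ?_⟩
  by_contra! hlt
  have hle := hcT _ hlt Z hZ
  have hupper : ∑ j ∈ (Finset.univ.filter fun j => ν ≤ colNorm Z j)ᶜ, colNorm Z j ≤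
      ∑ _j : Fin r, c T₀ / (r + 1) := by
    have hnn : 0 ≤ c T₀ / (r + 1) := by have := hc T₀; positivity
    refine (Finset.sum_le_sum fun j hj => ?_).trans
      (Finset.sum_le_sum_of_subset_of_nonneg (Finset.subset_univ _) fun _ _ _ => hnn)
    exact (lt_of_not_ge (by simpa using hj)).le.trans hν.le
  have hbound : (r : ℝ) * (c T₀ / (r + 1)) < c T₀ := by
    rw [mul_div_assoc', div_lt_iff₀ (by positivity)]
    linarith [hc T₀]
  simp only [Finset.sum_const, Finset.card_univ, Fintype.card_fin, nsmul_eq_mul] at hupper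
  linarith [hT₀ (Finset.univ.filter fun j => ν ≤ colNorm Z j)]

/-- Coincidence of global minimizers in the matrix case of Theorem 3.2: there is `ν̄ > 0`
such that for every `0 < ν < ν̄` and every `ψ` admissible for `ν`, a matrix `Z* ∈ Ω`
minimizes `‖Z‖_{F,0}` over `Ω` iff it minimizes `‖Z‖_{F,1}^ψ` over `Ω`. -/
theorem sparsity_minimizer_iff_psiNorm_minimizer {n1 n2 r : ℕ}
    (L : Matrix (Fin n1) (Fin n2) ℝ) (hr1 : L.rank ≤ r) (hr2 : r ≤ min n1 n2) :
    ∃ νbar : ℝ, 0 < νbar ∧ ∀ ν : ℝ, 0 < ν → ν < νbar → ∀ ψ : ℝ → ℝ, Admissible ν ψ →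
      ∀ Zstar ∈ Omega r L,
        ((∀ Z ∈ Omega r L, colSparsity Zstar ≤ colSparsity Z) ↔
          (∀ Z ∈ Omega r L, psiNorm ψ Zstar ≤ psiNorm ψ Z)) := by
  rcases (Omega r L).eq_empty_or_nonempty with hempty | hne
  · exact ⟨1, one_pos, fun ν _ _ ψ _ Z hZ => by simp [hempty] at hZ⟩
  obtain ⟨Z₀, hZ₀, hlt⟩ := (measure (colSparsity (n := n2) (r := r))).wf.has_min _ hne
  have hmin : ∀ Z ∈ Omega r L, colSparsity Z₀ ≤ colSparsity Z := fun Z hZ => not_lt.mp (hlt Z hZ)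
  obtain ⟨ε, hε, hcard⟩ := (isCompact_Omega r L).exists_pos_le_card_colNorm_ge hmin
  refine ⟨ε, hε, fun ν hν hνε ψ hψ Z hZ => ⟨fun h Z' hZ' => ?_, fun h Z' hZ' => ?_⟩⟩
  · calc psiNorm ψ Z ≤ colSparsity Z := hψ.psiNorm_le_colSparsity Z
      _ ≤ colSparsity Z₀ := mod_cast h Z₀ hZ₀
      _ ≤ (Finset.univ.filter fun j => ν ≤ colNorm Z' j).card := mod_cast hcard ν hνε Z' hZ'
      _ ≤ psiNorm ψ Z' := hψ.card_le_psiNorm hν Z'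
  · have hle : psiNorm ψ Z ≤ colSparsity Z₀ := (h Z₀ hZ₀).trans (hψ.psiNorm_le_colSparsity Z₀)
    have hlower := hψ.card_le_psiNorm hν Z
    have hcardZ := hcard ν hνε Z hZ
    have hsparse := hψ.colSparsity_le_card_of_psiNorm_le hν
      (hle.trans (by exact_mod_cast hcardZ))
    have hcard_le : (Finset.univ.filter fun j => ν ≤ colNorm Z j).card ≤ colSparsity Z₀ := by
      exact_mod_cast hlower.trans hle
    exact hsparse.trans (hcard_le.trans (hmin Z' hZ'))
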